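/- arXiv:0905.2925 — 7 statements merged into one kernel-verified Lean document; each statement's English description precedes it below -/
import Mathlib

section
/- Let n ≥ 1 and let λ, λ' : {0,1,…,n} → ℝ be dominant (λ(0) ≥ λ(1) ≥ … ≥ λ(n), and likewise for λ'), integral (λ(i) − λ(j) ∈ ℤ for all i,j, and likewise for λ'), and normalized (∑_k λ(k) = ∑_k λ'(k) = 0). If λ ≠ λ', then ∫_{[0,1]^n} 𝒞_λ(t) · conj(𝒞_{λ'}(t)) dt = 0. -/
open MeasureTheory in
/-- A nontrivial character of the circle integrates to zero over a full period. -/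
theorem integral_Icc_exp_two_pi_mul_int {m : ℤ} (hm : m ≠ 0) :
    ∫ x in Set.Icc (0 : ℝ) 1, Complex.exp (2 * Real.pi * Complex.I * m * x) = 0 := by
  have hc : 2 * Real.pi * Complex.I * (m : ℂ) ≠ 0 :=
    mul_ne_zero Complex.two_pi_I_ne_zero (Int.cast_ne_zero.2 hm)
  rw [integral_Icc_eq_integral_Ioc, ← intervalIntegral.integral_of_le zero_le_one,
    integral_exp_mul_complex hc]
  have h1 : Complex.exp (2 * Real.pi * Complex.I * m) = 1 :=
    Complex.exp_eq_one_iff.2 ⟨m, by ring⟩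
  simp [h1]

open MeasureTheory in
/-- A nontrivial character of the torus integrates to zero over the unit cube. -/
theorem integral_pi_Icc_exp_two_pi_sum_int {ι : Type*} [Fintype ι] {m : ι → ℤ} (hm : m ≠ 0) :
    ∫ t in Set.univ.pi fun _ : ι => Set.Icc (0 : ℝ) 1,
      Complex.exp (2 * Real.pi * Complex.I * ((∑ j, (m j : ℝ) * t j : ℝ) : ℂ)) = 0 := by
  obtain ⟨i, hi⟩ := Function.ne_iff.1 hm
  have hprod (t : ι → ℝ) :
      Complex.exp (2 * Real.pi * Complex.I * ((∑ j, (m j : ℝ) * t j : ℝ) : ℂ)) =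
        ∏ j, Complex.exp (2 * Real.pi * Complex.I * m j * t j) := by
    rw [← Complex.exp_sum]
    push_cast
    rw [Finset.mul_sum]
    simp only [mul_assoc]
  simp_rw [hprod]
  rw [volume_pi, Measure.restrict_pi_pi,
    integral_fintype_prod_eq_prod
      (f := fun j (x : ℝ) => Complex.exp (2 * Real.pi * Complex.I * m j * x))]
  exact Finset.prod_eq_zero (Finset.mem_univ i) (integral_Icc_exp_two_pi_mul_int hi)

open MeasureTheory in
/-- Trigonometric sums on the torus with disjoint spectra are orthogonal. -/
theorem integral_pi_Icc_sum_exp_mul_conj_sum_exp {ι κ κ' : Type*} [Fintype ι] [Fintype κ]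
    [Fintype κ'] {p : κ → ι → ℤ} {q : κ' → ι → ℤ} (hpq : ∀ x y, p x ≠ q y) :
    ∫ t in Set.univ.pi fun _ : ι => Set.Icc (0 : ℝ) 1,
      (∑ x, Complex.exp (2 * Real.pi * Complex.I * ((∑ j, (p x j : ℝ) * t j : ℝ) : ℂ))) *
        (starRingEnd ℂ)
          (∑ y, Complex.exp (2 * Real.pi * Complex.I * ((∑ j, (q y j : ℝ) * t j : ℝ) : ℂ))) =
      0 := by
  have hterm (x : κ) (y : κ') (t : ι → ℝ) :
      Complex.exp (2 * Real.pi * Complex.I * ((∑ j, (p x j : ℝ) * t j : ℝ) : ℂ)) *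
        (starRingEnd ℂ)
          (Complex.exp (2 * Real.pi * Complex.I * ((∑ j, (q y j : ℝ) * t j : ℝ) : ℂ))) =
      Complex.exp (2 * Real.pi * Complex.I *
        ((∑ j, ((p x - q y) j : ℝ) * t j : ℝ) : ℂ)) := by
    rw [← Complex.exp_conj, ← Complex.exp_add]
    simp only [map_mul, Complex.conj_I, Complex.conj_ofReal, map_ofNat, Pi.sub_apply]
    push_cast
    simp only [sub_mul, Finset.sum_sub_distrib]
    ring_nf
  have hintegrable (m : ι → ℤ) :
      IntegrableOn (fun t : ι → ℝ =>
        Complex.exp (2 * Real.pi * Complex.I * ((∑ j, (m j : ℝ) * t j : ℝ) : ℂ)))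
        (Set.univ.pi fun _ : ι => Set.Icc (0 : ℝ) 1) :=
    (Continuous.continuousOn (by fun_prop)).integrableOn_compact
      (isCompact_univ_pi fun _ => isCompact_Icc)
  simp_rw [map_sum, Finset.sum_mul_sum, hterm]
  rw [integral_finsetSum _ fun x _ => integrable_finsetSum _ fun y _ => hintegrable (p x - q y)]
  refine Finset.sum_eq_zero fun x _ => ?_
  rw [integral_finsetSum _ fun y _ => hintegrable (p x - q y)]
  exact Finset.sum_eq_zero fun y _ =>
    integral_pi_Icc_exp_two_pi_sum_int (sub_ne_zero.2 (hpq x y))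

/-- Antitone tuples that are rearrangements of each other are equal. -/
theorem eq_of_antitone_of_comp_perm_eq {n : ℕ} {α : Type*} [LinearOrder α] {f g : Fin n → α}
    (hf : Antitone f) (hg : Antitone g) {s s' : Equiv.Perm (Fin n)} (h : f ∘ s = g ∘ s') :
    f = g := by
  have hg' : g = f ∘ (s'.symm.trans s) := by
    funext i
    simpa using (congrFun h (s'.symm i)).symm
  have := Tuple.unique_monotone (f := OrderDual.toDual ∘ f) (σ := Equiv.refl _)
    (τ := s'.symm.trans s) hf.dual_right (by
      have := hg.dual_right
      rw [hg'] at this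
      exact this)
  rw [hg']
  exact this

/-- Tuples with equal successive differences and equal sums are equal. -/
theorem eq_of_sub_succ_eq_of_sum_eq {n : ℕ} {f g : Fin (n + 1) → ℝ}
    (h : ∀ j : Fin n, f j.castSucc - f j.succ = g j.castSucc - g j.succ)
    (hsum : ∑ k, f k = ∑ k, g k) : f = g := by
  have hconst (k : Fin (n + 1)) : f k - g k = f 0 - g 0 := by
    induction k using Fin.induction with
    | zero => rfl
    | succ j ih => linarith [h j]
  have hzero : f 0 - g 0 = 0 := by
    have : ∑ k, (f k - g k) = 0 := by rw [Finset.sum_sub_distrib, hsum, sub_self]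
    simp_rw [hconst, Finset.sum_const, Finset.card_univ, Fintype.card_fin, nsmul_eq_mul] at this
    exact (mul_eq_zero.1 this).resolve_left (by positivity)
  funext k
  linarith [hconst k]


open MeasureTheory in
/-- Continuous orthogonality of `C`-orbit functions of `A_n` labeled by two
distinct dominant, integral, normalized weights, over a unit cell in the
simple-root basis. -/
theorem stmt_7 (n : ℕ) (hn : 1 ≤ n) (lam lam' : Fin (n + 1) → ℝ)
    (hdom : ∀ i : Fin n, lam i.succ ≤ lam i.castSucc)
    (hdom' : ∀ i : Fin n, lam' i.succ ≤ lam' i.castSucc)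
    (hint : ∀ i j : Fin (n + 1), ∃ m : ℤ, lam i - lam j = m)
    (hint' : ∀ i j : Fin (n + 1), ∃ m : ℤ, lam' i - lam' j = m)
    (hsum : ∑ k : Fin (n + 1), lam k = 0)
    (hsum' : ∑ k : Fin (n + 1), lam' k = 0)
    (hne : lam ≠ lam') :
    ∫ t in Set.univ.pi fun _ : Fin n => Set.Icc (0 : ℝ) 1,
      (∑ s : Equiv.Perm (Fin (n + 1)),
          Complex.exp (2 * Real.pi * Complex.I *
            ((∑ j : Fin n, (lam (s j.castSucc) - lam (s j.succ)) * t j : ℝ) : ℂ))) *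
        (starRingEnd ℂ)
          (∑ s : Equiv.Perm (Fin (n + 1)),
            Complex.exp (2 * Real.pi * Complex.I *
              ((∑ j : Fin n, (lam' (s j.castSucc) - lam' (s j.succ)) * t j : ℝ) : ℂ))) = 0 := by
  choose a ha using hint
  choose b hb using hint'
  simp_rw [ha, hb]
  have hdisjoint (s s' : Equiv.Perm (Fin (n + 1))) :
      (fun j : Fin n => a (s j.castSucc) (s j.succ)) ≠
        fun j : Fin n => b (s' j.castSucc) (s' j.succ) := by
    intro h
    refine hne (eq_of_antitone_of_comp_perm_eq (Fin.antitone_iff_succ_le.2 hdom)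
      (Fin.antitone_iff_succ_le.2 hdom') (s := s) (s' := s') (eq_of_sub_succ_eq_of_sum_eq ?_ ?_))
    · intro j
      simp only [Function.comp_apply, ha, hb]
      exact_mod_cast congrFun h j
    · simp only [Function.comp_apply]
      rw [Equiv.sum_comp s lam, Equiv.sum_comp s' lam', hsum, hsum']
  exact integral_pi_Icc_sum_exp_mul_conj_sum_exp hdisjoint
end

section
/- Let n ≥ 1 and let λ : {0,1,…,n} → ℝ be dominant (λ(0) ≥ λ(1) ≥ … ≥ λ(n)), integral (λ(i) − λ(j) ∈ ℤ for all i,j), and normalized (∑_k λ(k) = 0). Then ∫_{[0,1]^n} |𝒞_λ(t)|² dt = (n+1)! · #{s ∈ S_{n+1} : λ ∘ s = λ}. -/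
open MeasureTheory in
theorem integral_Icc_exp_two_pi_int (m : ℤ) :
    ∫ x in Set.Icc (0 : ℝ) 1, Complex.exp (2 * Real.pi * Complex.I * (m * x)) =
      if m = 0 then 1 else 0 := by
  rw [integral_Icc_eq_integral_Ioc, ← intervalIntegral.integral_of_le zero_le_one]
  split_ifs with h
  · simp [h]
  · have hc : (2 * Real.pi * Complex.I * m : ℂ) ≠ 0 := by
      simp [h, Real.pi_ne_zero]
    have he : Complex.exp (2 * Real.pi * Complex.I * m) = 1 :=
      Complex.exp_eq_one_iff.2 ⟨m, by ring⟩
    simp_rw [← mul_assoc]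
    rw [integral_exp_mul_complex hc]
    simp [he]

open MeasureTheory in
theorem integral_unitCube_exp_two_pi_int {ι : Type*} [Fintype ι] (m : ι → ℤ) :
    ∫ t in Set.univ.pi fun _ : ι => Set.Icc (0 : ℝ) 1,
      Complex.exp (2 * Real.pi * Complex.I * ∑ j, (m j * t j : ℂ)) =
      if m = 0 then 1 else 0 := by
  simp_rw [Finset.mul_sum, Complex.exp_sum]
  rw [volume_pi, Measure.restrict_pi_pi,
    integral_fintype_prod_eq_prod
      (fun j (x : ℝ) => Complex.exp (2 * Real.pi * Complex.I * (m j * x)))]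
  simp_rw [integral_Icc_exp_two_pi_int]
  simp [Finset.prod_ite_zero, funext_iff]

open MeasureTheory in
/-- Parseval's identity for a finite sum of characters of the torus, with multiplicities. -/
theorem integral_unitCube_norm_sum_exp_sq {ι κ : Type*} [Fintype ι] [Fintype κ]
    (m : κ → ι → ℤ) :
    ∫ t in Set.univ.pi fun _ : ι => Set.Icc (0 : ℝ) 1,
      ‖∑ s, Complex.exp (2 * Real.pi * Complex.I * ∑ j, (m s j * t j : ℂ))‖ ^ 2 =
      ∑ s, ∑ s', if m s = m s' then (1 : ℝ) else 0 := by
  have key (t : ι → ℝ) :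
      ((‖∑ s, Complex.exp (2 * Real.pi * Complex.I * ∑ j, (m s j * t j : ℂ))‖ ^ 2 : ℝ) : ℂ) =
        ∑ s, ∑ s', Complex.exp
          (2 * Real.pi * Complex.I * ∑ j, (((m s - m s') j : ℤ) * t j : ℂ)) := by
    rw [Complex.ofReal_pow, ← Complex.mul_conj', map_sum, Finset.sum_mul_sum]
    refine Finset.sum_congr rfl fun s _ => Finset.sum_congr rfl fun s' _ => ?_
    rw [← Complex.exp_conj, ← Complex.exp_add]
    simp only [map_mul, map_sum, Complex.conj_ofNat, Complex.conj_ofReal, Complex.conj_I, map_intCast,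
      Pi.sub_apply, Int.cast_sub, sub_mul, Finset.sum_sub_distrib]
    ring_nf
  have hint (m : ι → ℤ) : Integrable
      (fun t : ι → ℝ => Complex.exp (2 * Real.pi * Complex.I * ∑ j, (m j * t j : ℂ)))
      (volume.restrict (Set.univ.pi fun _ : ι => Set.Icc (0 : ℝ) 1)) :=
    (Continuous.continuousOn (by fun_prop)).integrableOn_compact
      (isCompact_univ_pi fun _ => isCompact_Icc)
  apply Complex.ofReal_injective
  rw [← integral_complex_ofReal]
  simp_rw [key]
  rw [integral_finsetSum _ fun s _ => integrable_finsetSum _ fun s' _ => hint _]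
  simp_rw [integral_finsetSum _ fun s' _ => hint _, integral_unitCube_exp_two_pi_int, sub_eq_zero]
  simp only [Complex.ofReal_sum, apply_ite Complex.ofReal, Complex.ofReal_one, Complex.ofReal_zero]

/-- A function on `Fin (n + 1)` is determined by its sum and its successive differences. -/
theorem eq_of_sum_eq_of_castSucc_sub_succ_eq {n : ℕ} {f g : Fin (n + 1) → ℝ}
    (hs : ∑ k, f k = ∑ k, g k)
    (hd : ∀ j : Fin n, f j.castSucc - f j.succ = g j.castSucc - g j.succ) : f = g := by
  have h0 (k : Fin (n + 1)) : f k - g k = f 0 - g 0 := by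
    induction k using Fin.induction with
    | zero => rfl
    | succ j ih => linarith [hd j]
  have h1 : ∑ k, (f k - g k) = 0 := by rw [Finset.sum_sub_distrib, hs, sub_self]
  simp_rw [h0] at h1
  have h2 : f 0 - g 0 = 0 := by
    rw [Finset.sum_const, Finset.card_univ, Fintype.card_fin, nsmul_eq_mul] at h1
    exact (mul_eq_zero.1 h1).resolve_left (Nat.cast_ne_zero.2 n.succ_ne_zero)
  funext k
  linarith [h0 k]

open scoped Classical in
/-- Each fibre of `s ↦ f ∘ s` is a coset of the stabilizer of `f`. -/
theorem card_filter_comp_perm_eq {ι α : Type*} [Fintype ι] (f : ι → α) (s : Equiv.Perm ι) :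
    (Finset.univ.filter fun s' : Equiv.Perm ι => f ∘ s = f ∘ s').card =
      (Finset.univ.filter fun s' : Equiv.Perm ι => f ∘ s' = f).card := by
  refine Finset.card_equiv (Equiv.mulRight s⁻¹) fun s' => ?_
  simp only [Finset.mem_filter, Finset.mem_univ, true_and, funext_iff, Function.comp_apply,
    Equiv.coe_mulRight, Equiv.Perm.mul_apply]
  constructor
  · intro h x
    simpa using (h (s⁻¹ x)).symm
  · intro h x
    simpa using (h (s x)).symm


open scoped Classical in
open MeasureTheory in
/-- Squared `L²`-norm of a `C`-orbit function of `A_n` over a unit cell in the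
simple-root basis: `∫ |𝒞_λ|² = (n+1)! · #Stab(λ)`. -/
theorem stmt_8 (n : ℕ) (hn : 1 ≤ n) (lam : Fin (n + 1) → ℝ)
    (hdom : ∀ i : Fin n, lam i.succ ≤ lam i.castSucc)
    (hint : ∀ i j : Fin (n + 1), ∃ m : ℤ, lam i - lam j = m)
    (hsum : ∑ k : Fin (n + 1), lam k = 0) :
    ∫ t in Set.univ.pi fun _ : Fin n => Set.Icc (0 : ℝ) 1,
      ‖∑ s : Equiv.Perm (Fin (n + 1)),
          Complex.exp (2 * Real.pi * Complex.I *
            ((∑ j : Fin n, (lam (s j.castSucc) - lam (s j.succ)) * t j : ℝ) : ℂ))‖ ^ 2 =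
      (Nat.factorial (n + 1) : ℝ) *
        (Finset.univ.filter fun s : Equiv.Perm (Fin (n + 1)) => lam ∘ s = lam).card := by
  choose d hd using hint
  let m (s : Equiv.Perm (Fin (n + 1))) (j : Fin n) : ℤ := d (s j.castSucc) (s j.succ)
  have hm (s s' : Equiv.Perm (Fin (n + 1))) : m s = m s' ↔ lam ∘ s = lam ∘ s' := by
    constructor
    · intro h
      refine eq_of_sum_eq_of_castSucc_sub_succ_eq ?_ fun j => ?_
      · simp only [Function.comp_apply, Equiv.sum_comp]
      · simp only [Function.comp_apply, hd]
        exact congrArg _ (congrFun h j)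
    · intro h
      funext j
      have h1 := congrFun h j.castSucc
      have h2 := congrFun h j.succ
      simp only [Function.comp_apply] at h1 h2
      have : ((m s j : ℤ) : ℝ) = m s' j := by simp only [m, ← hd, h1, h2]
      exact_mod_cast this
  have h := integral_unitCube_norm_sum_exp_sq m
  have hfib (s : Equiv.Perm (Fin (n + 1))) :
      ∑ s', (if m s = m s' then (1 : ℝ) else 0) =
        (Finset.univ.filter fun s : Equiv.Perm (Fin (n + 1)) => lam ∘ s = lam).card := by
    rw [Finset.sum_boole]
    congr 1
    convert card_filter_comp_perm_eq lam s using 2 <;>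
    · ext s'
      simp [hm]
  rw [Finset.sum_congr rfl fun s _ => hfib s,
    Finset.sum_const, Finset.card_univ, Fintype.card_perm, Fintype.card_fin, nsmul_eq_mul] at h
  rw [← h]
  simp_rw [hd]
  push_cast
  rfl
end

section
/- Let n ≥ 1 and let λ : {0,1,…,n} → ℝ be strictly dominant (λ(0) > λ(1) > … > λ(n)), integral (λ(i) − λ(j) ∈ ℤ for all i,j), and normalized (∑_k λ(k) = 0). Then ∫_{[0,1]^n} |𝒮_λ(t)|² dt = (n+1)!. -/
open MeasureTheory in
/-- Orthogonality of the characters of the circle, as functions on the unit interval. -/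
theorem integral_Icc_exp_two_pi_I_mul_int (k : ℤ) :
    ∫ x in Set.Icc (0 : ℝ) 1, Complex.exp (2 * Real.pi * Complex.I * k * x) =
      if k = 0 then 1 else 0 := by
  rw [integral_Icc_eq_integral_Ioc, ← intervalIntegral.integral_of_le zero_le_one]
  split_ifs with hk
  · simp [hk]
  · have hc : (2 * Real.pi * Complex.I * k : ℂ) ≠ 0 :=
      mul_ne_zero Complex.two_pi_I_ne_zero (Int.cast_ne_zero.mpr hk)
    have hper : Complex.exp (2 * Real.pi * Complex.I * k) = 1 := by
      rw [mul_comm]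
      exact Complex.exp_int_mul_two_pi_mul_I k
    rw [integral_exp_mul_complex hc]
    simp [hper]

open MeasureTheory in
/-- Orthogonality of the characters of the torus, as functions on the unit cube. -/
theorem integral_unitCube_prod_exp_two_pi_I {ι : Type*} [Fintype ι] (k : ι → ℤ) :
    ∫ t in Set.univ.pi fun _ : ι => Set.Icc (0 : ℝ) 1,
      ∏ j, Complex.exp (2 * Real.pi * Complex.I * k j * t j) = if k = 0 then 1 else 0 := by
  rw [volume_pi, Measure.restrict_pi_pi,
    integral_fintype_prod_eq_prod
      (f := fun (j : ι) (x : ℝ) => Complex.exp (2 * Real.pi * Complex.I * k j * x))]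
  simp_rw [integral_Icc_exp_two_pi_I_mul_int]
  rw [Finset.prod_ite_zero]
  simp [funext_iff]

open MeasureTheory in
/-- Parseval's identity for trigonometric polynomials on the unit cube. -/
theorem integral_unitCube_norm_sq_sum_exp {ι σ : Type*} [Fintype ι] [Fintype σ]
    (c : σ → ℂ) (m : σ → ι → ℤ) (hm : Function.Injective m) :
    ∫ t in Set.univ.pi fun _ : ι => Set.Icc (0 : ℝ) 1,
      ‖∑ s, c s * Complex.exp (2 * Real.pi * Complex.I * ((∑ j, m s j * t j : ℝ) : ℂ))‖ ^ 2 =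
      ∑ s, ‖c s‖ ^ 2 := by
  classical
  have expand : ∀ t : ι → ℝ,
      ((‖∑ s, c s * Complex.exp (2 * Real.pi * Complex.I *
        ((∑ j, m s j * t j : ℝ) : ℂ))‖ ^ 2 : ℝ) : ℂ) =
      ∑ s, ∑ r, c s * (starRingEnd ℂ) (c r) *
        ∏ j, Complex.exp (2 * Real.pi * Complex.I * ((m s - m r) j : ℤ) * t j) := by
    intro t
    rw [Complex.ofReal_pow, ← Complex.mul_conj', map_sum, Finset.sum_mul_sum]
    refine Finset.sum_congr rfl fun s _ => Finset.sum_congr rfl fun r _ => ?_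
    rw [map_mul, mul_mul_mul_comm, ← Complex.exp_conj, ← Complex.exp_add, ← Complex.exp_sum]
    congr 2
    simp only [map_mul, map_sum, map_intCast, Complex.conj_I, Complex.conj_ofReal, map_ofNat,
      Complex.ofReal_sum, Complex.ofReal_mul, Complex.ofReal_intCast, Finset.mul_sum, ← Finset.sum_add_distrib,
      Pi.sub_apply, Int.cast_sub]
    exact Finset.sum_congr rfl fun j _ => by ring
  have hint : ∀ s r, IntegrableOn (fun t : ι → ℝ => c s * (starRingEnd ℂ) (c r) *
      ∏ j, Complex.exp (2 * Real.pi * Complex.I * ((m s - m r) j : ℤ) * t j))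
      (Set.univ.pi fun _ : ι => Set.Icc (0 : ℝ) 1) := fun s r =>
    (Continuous.continuousOn (by fun_prop)).integrableOn_compact
      (isCompact_univ_pi fun _ => isCompact_Icc)
  apply Complex.ofReal_injective
  rw [← integral_complex_ofReal]
  simp_rw [expand]
  rw [integral_finsetSum _ fun s _ => integrable_finsetSum _ fun r _ => hint s r]
  simp_rw [integral_finsetSum _ fun r _ => hint _ r, integral_const_mul,
    integral_unitCube_prod_exp_two_pi_I, sub_eq_zero, hm.eq_iff]
  simp [Complex.mul_conj']

/-- A permutation is determined by the successive differences of an injective family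
rearranged along it. -/
theorem perm_eq_of_sub_succ_eq {n : ℕ} {lam : Fin (n + 1) → ℝ} (hinj : Function.Injective lam)
    {s r : Equiv.Perm (Fin (n + 1))}
    (h : ∀ j : Fin n, lam (s j.castSucc) - lam (s j.succ) =
      lam (r j.castSucc) - lam (r j.succ)) : s = r := by
  have hconst : ∀ i, lam (s i) - lam (r i) = lam (s 0) - lam (r 0) := by
    intro i
    induction i using Fin.induction with
    | zero => rfl
    | succ j ih => linarith [h j]
  have hzero : ∑ i, (lam (s i) - lam (r i)) = 0 := by
    rw [Finset.sum_sub_distrib, Equiv.sum_comp s lam, Equiv.sum_comp r lam, sub_self]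
  simp_rw [hconst] at hzero
  have h0 : lam (s 0) - lam (r 0) = 0 := by
    rw [Finset.sum_const, Finset.card_univ, Fintype.card_fin, nsmul_eq_mul] at hzero
    exact (mul_eq_zero.mp hzero).resolve_left (by positivity)
  ext1 i
  exact hinj (by linarith [hconst i])

open MeasureTheory in
/-- Norm formula for `S`-orbit functions of `A_n` over a unit cell in the
simple-root basis: `∫ |𝒮_λ|² = (n+1)!`. -/
theorem stmt_10 (n : ℕ) (hn : 1 ≤ n) (lam : Fin (n + 1) → ℝ)
    (hdom : ∀ i : Fin n, lam i.succ < lam i.castSucc)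
    (hint : ∀ i j : Fin (n + 1), ∃ m : ℤ, lam i - lam j = m)
    (hsum : ∑ k : Fin (n + 1), lam k = 0) :
    ∫ t in Set.univ.pi fun _ : Fin n => Set.Icc (0 : ℝ) 1,
      ‖∑ s : Equiv.Perm (Fin (n + 1)),
          ((Equiv.Perm.sign s : ℤ) : ℂ) *
            Complex.exp (2 * Real.pi * Complex.I *
              ((∑ j : Fin n, (lam (s j.castSucc) - lam (s j.succ)) * t j : ℝ) : ℂ))‖ ^ 2 =
      (Nat.factorial (n + 1) : ℝ) := by
  have hinj : Function.Injective lam := (Fin.strictAnti_iff_succ_lt.mpr hdom).injective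
  choose d hd using hint
  have hm : Function.Injective fun (s : Equiv.Perm (Fin (n + 1))) (j : Fin n) =>
      d (s j.castSucc) (s j.succ) := fun s r hsr =>
    perm_eq_of_sub_succ_eq hinj fun j => by
      rw [hd, hd]
      exact congrArg Int.cast (congrFun hsr j)
  simp_rw [hd]
  rw [integral_unitCube_norm_sq_sum_exp _ _ hm]
  have hsign : ∀ s : Equiv.Perm (Fin (n + 1)),
      ‖((Equiv.Perm.sign s : ℤ) : ℂ)‖ ^ 2 = 1 := fun s => by
    rcases Int.units_eq_one_or (Equiv.Perm.sign s) with h | h <;> simp [h]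
  simp_rw [hsign]
  simp [Fintype.card_perm]
end

section
/- Let n ≥ 1 and let λ, λ' : {0,1,…,n} → ℝ be dominant (λ(0) ≥ λ(1) ≥ … ≥ λ(n), and likewise for λ'), integral (λ(i) − λ(j) ∈ ℤ for all i,j, and likewise for λ'), and normalized (∑_k λ(k) = ∑_k λ'(k) = 0). If λ ≠ λ', then ∫_{[0,1]^n} ℰ_λ(t) · conj(ℰ_{λ'}(t)) dt = 0. -/
open MeasureTheory in
/-- A nontrivial integer character integrates to zero over the unit cube. -/
theorem integral_unitCube_exp_eq_zero {ι : Type*} [Fintype ι] (c : ι → ℝ)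
    (hint : ∀ j, ∃ m : ℤ, c j = m) (hne : c ≠ 0) :
    ∫ t in Set.univ.pi fun _ : ι => Set.Icc (0 : ℝ) 1,
      Complex.exp (2 * Real.pi * Complex.I * ((∑ j, c j * t j : ℝ) : ℂ)) = 0 := by
  obtain ⟨j, hj⟩ := Function.ne_iff.1 hne
  obtain ⟨m, hm⟩ := hint j
  have hm0 : m ≠ 0 := by
    rintro rfl
    simp [hm] at hj
  have hprod : ∀ t : ι → ℝ,
      Complex.exp (2 * Real.pi * Complex.I * ((∑ j, c j * t j : ℝ) : ℂ)) =
        ∏ j, Complex.exp (2 * Real.pi * Complex.I * c j * t j) := by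
    intro t
    rw [← Complex.exp_sum]
    push_cast
    simp only [Finset.mul_sum, mul_assoc]
  simp_rw [hprod]
  rw [volume_pi, Measure.restrict_pi_pi,
    integral_fintype_prod_eq_prod (fun j (x : ℝ) => Complex.exp (2 * Real.pi * Complex.I * c j * x))]
  refine Finset.prod_eq_zero (Finset.mem_univ j) ?_
  have h0 : (2 * Real.pi * Complex.I * c j : ℂ) ≠ 0 := by
    rw [hm]
    simp [Real.pi_ne_zero, hm0]
  rw [integral_Icc_eq_integral_Ioc, ← intervalIntegral.integral_of_le zero_le_one,
    integral_exp_mul_complex h0, hm]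
  have h1 : (2 * Real.pi * Complex.I * ((m : ℝ) : ℂ) * ((1 : ℝ) : ℂ)) =
      m * (2 * Real.pi * Complex.I) := by
    push_cast
    ring
  rw [h1, Complex.exp_int_mul_two_pi_mul_I]
  simp

/-- Two real tuples with equal sums and equal consecutive differences coincide. -/
theorem eq_of_forall_sub_eq_of_sum_eq {n : ℕ} {f g : Fin (n + 1) → ℝ}
    (hsub : ∀ j : Fin n, f j.castSucc - f j.succ = g j.castSucc - g j.succ)
    (hsum : ∑ k, f k = ∑ k, g k) : f = g := by
  have hconst : ∀ k, f k - g k = f 0 - g 0 := by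
    intro k
    induction k using Fin.induction with
    | zero => rfl
    | succ j ih => linarith [hsub j]
  have hzero : (n + 1 : ℝ) * (f 0 - g 0) = 0 := by
    have h : ∑ k, (f k - g k) = 0 := by rw [Finset.sum_sub_distrib, hsum, sub_self]
    simpa only [hconst, Finset.sum_const, Finset.card_univ, Fintype.card_fin, nsmul_eq_mul,
      Nat.cast_add, Nat.cast_one] using h
  have h0 : f 0 - g 0 = 0 := (mul_eq_zero.1 hzero).resolve_left (by positivity)
  ext k
  linarith [hconst k]

/-- Antitone tuples that agree up to permutations of their indices are equal. -/
theorem Antitone.eq_of_comp_perm_eq {n : ℕ} {f g : Fin n → ℝ} (hf : Antitone f) (hg : Antitone g)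
    {s s' : Equiv.Perm (Fin n)} (h : f ∘ s = g ∘ s') : f = g := by
  have hg' : g = f ∘ (s * s'⁻¹ : Equiv.Perm (Fin n)) := by
    ext k
    simpa using (congrFun h (s'⁻¹ k)).symm
  have := Tuple.unique_antitone (f := f) (σ := 1) (τ := s * s'⁻¹) (by simpa using hf) (hg' ▸ hg)
  rw [hg', ← this]
  rfl


open MeasureTheory in
/-- Continuous orthogonality of `E`-orbit functions of `A_n` (sums over the
alternating group) labeled by two distinct dominant, integral, normalized
weights, over a unit cell in the simple-root basis. -/
theorem stmt_11 (n : ℕ) (hn : 1 ≤ n) (lam lam' : Fin (n + 1) → ℝ)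
    (hdom : ∀ i : Fin n, lam i.succ ≤ lam i.castSucc)
    (hdom' : ∀ i : Fin n, lam' i.succ ≤ lam' i.castSucc)
    (hint : ∀ i j : Fin (n + 1), ∃ m : ℤ, lam i - lam j = m)
    (hint' : ∀ i j : Fin (n + 1), ∃ m : ℤ, lam' i - lam' j = m)
    (hsum : ∑ k : Fin (n + 1), lam k = 0)
    (hsum' : ∑ k : Fin (n + 1), lam' k = 0)
    (hne : lam ≠ lam') :
    ∫ t in Set.univ.pi fun _ : Fin n => Set.Icc (0 : ℝ) 1,
      (∑ s : alternatingGroup (Fin (n + 1)),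
          Complex.exp (2 * Real.pi * Complex.I *
            ((∑ j : Fin n, (lam ((s : Equiv.Perm (Fin (n + 1))) j.castSucc) -
                lam ((s : Equiv.Perm (Fin (n + 1))) j.succ)) * t j : ℝ) : ℂ))) *
        (starRingEnd ℂ)
          (∑ s : alternatingGroup (Fin (n + 1)),
            Complex.exp (2 * Real.pi * Complex.I *
              ((∑ j : Fin n, (lam' ((s : Equiv.Perm (Fin (n + 1))) j.castSucc) -
                  lam' ((s : Equiv.Perm (Fin (n + 1))) j.succ)) * t j : ℝ) : ℂ))) = 0 := by
  simp_rw [map_sum, Finset.sum_mul_sum]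
  have hcont : ∀ (f : Fin (n + 1) → ℝ), Continuous fun t : Fin n → ℝ =>
      Complex.exp (2 * Real.pi * Complex.I *
        ((∑ j : Fin n, (f j.castSucc - f j.succ) * t j : ℝ) : ℂ)) := by
    intro f
    fun_prop
  have hcompact : IsCompact (Set.univ.pi fun _ : Fin n => Set.Icc (0 : ℝ) 1) :=
    isCompact_univ_pi fun _ => isCompact_Icc
  have hintegrable : ∀ f g : Fin (n + 1) → ℝ, IntegrableOn (fun t : Fin n → ℝ =>
      Complex.exp (2 * Real.pi * Complex.I *
        ((∑ j : Fin n, (f j.castSucc - f j.succ) * t j : ℝ) : ℂ)) *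
      (starRingEnd ℂ) (Complex.exp (2 * Real.pi * Complex.I *
        ((∑ j : Fin n, (g j.castSucc - g j.succ) * t j : ℝ) : ℂ))))
      (Set.univ.pi fun _ : Fin n => Set.Icc (0 : ℝ) 1) := fun f g =>
    ((hcont f).mul (Complex.continuous_conj.comp (hcont g))).continuousOn.integrableOn_compact
      hcompact
  rw [integral_finsetSum]
  swap
  · exact fun s _ => integrable_finsetSum _ fun s' _ => hintegrable (lam ∘ s.1) (lam' ∘ s'.1)
  refine Finset.sum_eq_zero fun s _ => ?_
  rw [integral_finsetSum]
  swap
  · exact fun s' _ => hintegrable (lam ∘ s.1) (lam' ∘ s'.1)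
  refine Finset.sum_eq_zero fun s' _ => ?_
  set c : Fin n → ℝ := fun j => (lam (s.1 j.castSucc) - lam (s.1 j.succ)) -
    (lam' (s'.1 j.castSucc) - lam' (s'.1 j.succ)) with hc
  have hc_int : ∀ j, ∃ m : ℤ, c j = m := by
    intro j
    obtain ⟨a, ha⟩ := hint (s.1 j.castSucc) (s.1 j.succ)
    obtain ⟨b, hb⟩ := hint' (s'.1 j.castSucc) (s'.1 j.succ)
    exact ⟨a - b, by simp only [hc, ha, hb]; push_cast; rfl⟩
  have hc_ne : c ≠ 0 := by
    intro h
    refine hne (Antitone.eq_of_comp_perm_eq (Fin.antitone_iff_succ_le.2 hdom)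
      (Fin.antitone_iff_succ_le.2 hdom') (s := s.1) (s' := s'.1)
      (eq_of_forall_sub_eq_of_sum_eq (fun j => sub_eq_zero.1 (congrFun h j)) ?_))
    simp only [Function.comp_apply, Equiv.sum_comp, hsum, hsum']
  rw [← integral_unitCube_exp_eq_zero c hc_int hc_ne]
  congr 1
  ext t
  rw [← Complex.exp_conj, ← Complex.exp_add]
  congr 1
  simp only [hc, map_mul, Complex.conj_I, Complex.conj_ofReal, map_ofNat, sub_mul _ _ (t _),
    Finset.sum_sub_distrib]
  push_cast
  ring
end

section
/- Let n ≥ 1 and let λ : {0,1,…,n} → ℝ be dominant (λ(0) ≥ λ(1) ≥ … ≥ λ(n)), integral (λ(i) − λ(j) ∈ ℤ for all i,j) and normalized (∑_k λ(k) = 0). Then there exists a polynomial P in n variables with complex coefficients such that for every x : {0,1,…,n} → ℝ with ∑_{k=0}^{n} x(k) = 0, D⁺_λ(x) = P(X_1(x), X_2(x), …, X_n(x)). -/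
open MvPolynomial in
/-- On the hypersurface `∏ k, y k = 1`, a symmetric polynomial in `n + 1` variables is a polynomial
in the first `n` elementary symmetric polynomials. -/
theorem MvPolynomial.IsSymmetric.exists_eval_eq_of_prod_eq_one {R : Type*} [CommRing R] {n : ℕ}
    {p : MvPolynomial (Fin (n + 1)) R} (hp : p.IsSymmetric) :
    ∃ P : MvPolynomial (Fin n) R, ∀ y : Fin (n + 1) → R, ∏ k, y k = 1 →
      eval y p = eval (fun j : Fin n => eval y (esymm (Fin (n + 1)) R (j + 1))) P := by
  obtain ⟨q, hq⟩ := esymmAlgHom_surjective (σ := Fin (n + 1)) R (n := n + 1) (by simp) ⟨p, hp⟩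
  have hq' : aeval (fun i : Fin (n + 1) => esymm (Fin (n + 1)) R (i + 1)) q = p := by
    rw [← esymmAlgHom_apply, hq]
  refine ⟨aeval (Fin.snoc (α := fun _ => MvPolynomial (Fin n) R) X 1) q, fun y hy => ?_⟩
  rw [← hq', ← coe_aeval_eq_eval, ← coe_aeval_eq_eval, RingHom.coe_coe, RingHom.coe_coe,
    ← AlgHom.comp_apply, ← AlgHom.comp_apply, comp_aeval, comp_aeval]
  congr 2
  funext i
  refine Fin.lastCases ?_ (fun j => ?_) i
  · have h : Finset.powersetCard (n + 1) (Finset.univ : Finset (Fin (n + 1))) = {Finset.univ} := by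
      simpa using Finset.powersetCard_self (Finset.univ : Finset (Fin (n + 1)))
    simp [esymm, h, hy]
  · simp

/-- The symmetrization of a monomial is a symmetric polynomial. -/
theorem MvPolynomial.isSymmetric_sum_perm_prod_X_pow {σ R : Type*} [Fintype σ] [DecidableEq σ]
    [CommSemiring R] (m : σ → ℕ) :
    (∑ s : Equiv.Perm σ, ∏ k, (X k : MvPolynomial σ R) ^ m (s k)).IsSymmetric := by
  intro e
  simp only [map_sum, map_prod, map_pow, rename_X]
  refine Fintype.sum_equiv (Equiv.mulRight e⁻¹) _ _ fun s => ?_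
  refine Fintype.prod_equiv e _ _ fun k => ?_
  simp

/-- A dominant integral weight of `A_n` is, up to a constant shift, a vector of naturals. -/
theorem exists_nat_add_last_eq {n : ℕ} {lam : Fin (n + 1) → ℝ}
    (hdom : ∀ i : Fin n, lam i.succ ≤ lam i.castSucc)
    (hint : ∀ i j : Fin (n + 1), ∃ m : ℤ, lam i - lam j = m) :
    ∃ m : Fin (n + 1) → ℕ, ∀ k, lam k = m k + lam (Fin.last n) := by
  suffices h : ∀ k, ∃ m : ℕ, lam k = m + lam (Fin.last n) from ⟨_, fun k => (h k).choose_spec⟩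
  intro k
  obtain ⟨m, hm⟩ := hint k (Fin.last n)
  have h : (0 : ℝ) ≤ m := by
    rw [← hm, sub_nonneg]
    exact Fin.antitone_iff_succ_le.2 hdom (Fin.le_last k)
  lift m to ℕ using by exact_mod_cast h
  exact ⟨m, by simpa [sub_eq_iff_eq_add] using hm⟩


/-- Every `C`-orbit function of `A_n` (the symmetric exponential sum `D⁺_λ`)
restricted to the hyperplane `∑ x k = 0` is a polynomial in the `n`
fundamental `C`-orbit functions `X_1, …, X_n` (the multivariate Chebyshev
polynomials of the first kind). -/
theorem stmt_17 (n : ℕ) (hn : 1 ≤ n) (lam : Fin (n + 1) → ℝ)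
    (hdom : ∀ i : Fin n, lam i.succ ≤ lam i.castSucc)
    (hint : ∀ i j : Fin (n + 1), ∃ m : ℤ, lam i - lam j = m)
    (hsum : ∑ k : Fin (n + 1), lam k = 0) :
    ∃ P : MvPolynomial (Fin n) ℂ,
      ∀ x : Fin (n + 1) → ℝ, (∑ k : Fin (n + 1), x k = 0) →
        ∑ s : Equiv.Perm (Fin (n + 1)),
            Complex.exp (2 * Real.pi * Complex.I *
              ((∑ k : Fin (n + 1), lam (s k) * x k : ℝ) : ℂ)) =
          MvPolynomial.eval
            (fun j : Fin n =>
              ∑ S ∈ (Finset.univ : Finset (Fin (n + 1))).powersetCard ((j : ℕ) + 1),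
                Complex.exp (2 * Real.pi * Complex.I * ((∑ k ∈ S, x k : ℝ) : ℂ))) P := by
  obtain ⟨m, hm⟩ := exists_nat_add_last_eq hdom hint
  obtain ⟨P, hP⟩ := (MvPolynomial.isSymmetric_sum_perm_prod_X_pow
    (R := ℂ) m).exists_eval_eq_of_prod_eq_one
  have hexp (S : Finset (Fin (n + 1))) (f : Fin (n + 1) → ℝ) :
      Complex.exp (2 * Real.pi * Complex.I * ((∑ k ∈ S, f k : ℝ) : ℂ)) =
        ∏ k ∈ S, Complex.exp (2 * Real.pi * Complex.I * (f k : ℂ)) := by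
    rw [Complex.ofReal_sum, Finset.mul_sum, Complex.exp_sum]
  refine ⟨P, fun x hx => ?_⟩
  have hy : ∏ k, Complex.exp (2 * Real.pi * Complex.I * (x k : ℂ)) = 1 := by
    rw [← hexp, hx]
    simp
  have hshift (s : Equiv.Perm (Fin (n + 1))) :
      ∑ k, lam (s k) * x k = ∑ k, (m (s k) : ℝ) * x k := by
    simp only [hm (s _), add_mul, Finset.sum_add_distrib, ← Finset.mul_sum, hx, mul_zero, add_zero]
  convert hP _ hy using 1
  · simp only [map_sum, map_prod, map_pow, MvPolynomial.eval_X]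
    refine Finset.sum_congr rfl fun s _ => ?_
    rw [hshift, hexp]
    refine Finset.prod_congr rfl fun k _ => ?_
    rw [← Complex.exp_nat_mul]
    push_cast
    ring_nf
  · simp only [MvPolynomial.esymm, map_sum, map_prod, MvPolynomial.eval_X, hexp]
end

section
/- Let n ≥ 1 and let λ : {0,1,…,n} → ℝ be strictly dominant (λ(0) > λ(1) > … > λ(n)), integral (λ(i) − λ(j) ∈ ℤ for all i,j) and normalized (∑_k λ(k) = 0). Let δ : {0,1,…,n} → ℝ be given by δ(k) := n − k. Then there exists a polynomial P in n variables with complex coefficients such that for every x : {0,1,…,n} → ℝ with ∑_{k=0}^{n} x(k) = 0, D⁻_λ(x) = D⁻_δ(x) · P(X_1(x), X_2(x), …, X_n(x)). -/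
open Polynomial in
/-- Over `MvPolynomial (Fin n) R`, whose variables stand for the elementary symmetric functions
`e₁, …, eₙ`, there is a monic polynomial of degree `n + 1` specializing to `∏ k, (T - z k)` for
every `z` with `∏ k, z k = 1`. -/
theorem exists_monic_map_eq_prod_X_sub_C (R : Type*) [CommRing R] [Nontrivial R] (n : ℕ) :
    ∃ Q : (MvPolynomial (Fin n) R)[X], Q.Monic ∧ Q.natDegree = n + 1 ∧
      ∀ z : Fin (n + 1) → R, ∏ k, z k = 1 →
        Q.map (MvPolynomial.eval fun j : Fin n =>
          ∑ S ∈ (Finset.univ : Finset (Fin (n + 1))).powersetCard ((j : ℕ) + 1), ∏ k ∈ S, z k) =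
          ∏ k, (X - C (z k)) := by
  let a : Fin (n + 1) → MvPolynomial (Fin n) R :=
    Fin.cons ((-1) ^ (n + 1)) fun i => (-1) ^ (n - (i : ℕ)) * MvPolynomial.X i.rev
  have hdeg : (∑ i : Fin (n + 1), C (a i) * X ^ (i : ℕ)).degree < ((n + 1 : ℕ) : WithBot ℕ) :=
    Polynomial.degree_sum_fin_lt a
  refine ⟨X ^ (n + 1) + ∑ i : Fin (n + 1), C (a i) * X ^ (i : ℕ), monic_X_pow_add hdeg,
    natDegree_eq_of_degree_eq_some ?_, fun z hz => ?_⟩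
  · rw [degree_add_eq_left_of_degree_lt (by simpa using hdeg), degree_X_pow]
  have hmonic : (∏ k, (X - C (z k))).Monic := monic_prod_of_monic _ _ fun k _ => monic_X_sub_C _
  have hnat : (∏ k, (X - C (z k))).natDegree = n + 1 := by simp
  rw [hmonic.as_sum, hnat, Finset.sum_range]
  simp only [Polynomial.map_add, Polynomial.map_pow, map_X, Polynomial.map_sum,
    Polynomial.map_mul, map_C]
  congr 1
  refine Finset.sum_congr rfl fun i _ => ?_
  congr 2
  have hprod : ∏ k, (X - C (z k)) =
      (((Finset.univ : Finset (Fin (n + 1))).val.map z).map fun t => X - C t).prod := by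
    rw [Multiset.map_map]; rfl
  rw [hprod, Multiset.prod_X_sub_C_coeff _ (by simp)]
  rw [Multiset.card_map, Finset.card_val, Finset.card_univ, Fintype.card_fin,
    Finset.esymm_map_val]
  refine Fin.cases ?_ (fun i => ?_) i
  · have huniv : (Finset.univ : Finset (Fin (n + 1))).powersetCard (n + 1) = {Finset.univ} := by
      simpa using Finset.powersetCard_self (Finset.univ : Finset (Fin (n + 1)))
    simp [a, huniv, hz]
  · have hi : n - ((i : ℕ) + 1) + 1 = n - i := by omega
    simp [a, Fin.val_rev, hi]

/-- A generalized Vandermonde determinant is a multiple of the Vandermonde determinant by a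
polynomial in the elementary symmetric functions. -/
theorem exists_det_pow_eq_det_vandermonde_mul_eval (R : Type*) [CommRing R] [Nontrivial R]
    (n : ℕ) (m : Fin (n + 1) → ℕ) :
    ∃ P : MvPolynomial (Fin n) R, ∀ z : Fin (n + 1) → R, ∏ k, z k = 1 →
      (Matrix.of fun j k => z k ^ m j).det =
        (Matrix.of fun j k : Fin (n + 1) => z k ^ (n - (j : ℕ))).det *
          MvPolynomial.eval (fun j : Fin n =>
            ∑ S ∈ (Finset.univ : Finset (Fin (n + 1))).powersetCard ((j : ℕ) + 1),
              ∏ k ∈ S, z k) P := by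
  obtain ⟨Q, hQ, hdeg, hmap⟩ := exists_monic_map_eq_prod_X_sub_C R n
  let c : Matrix (Fin (n + 1)) (Fin (n + 1)) (MvPolynomial (Fin n) R) :=
    Matrix.of fun j i => ((Polynomial.X : Polynomial _) ^ m j %ₘ Q).coeff (n - (i : ℕ))
  refine ⟨c.det, fun z hz => ?_⟩
  specialize hmap z hz
  set φ := MvPolynomial.eval fun j : Fin n =>
    ∑ S ∈ (Finset.univ : Finset (Fin (n + 1))).powersetCard ((j : ℕ) + 1), ∏ k ∈ S, z k
  rw [RingHom.map_det, mul_comm, ← Matrix.det_mul]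
  congr 1
  ext j k
  have hroot : (Q.map φ).eval (z k) = 0 := by
    rw [hmap, Polynomial.eval_prod]
    exact Finset.prod_eq_zero (Finset.mem_univ k) (by simp)
  have hlt : (((Polynomial.X : Polynomial _) ^ m j %ₘ Q).map φ).natDegree < n + 1 := by
    refine (Polynomial.natDegree_map_le).trans_lt ?_
    rw [← hdeg]
    refine Polynomial.natDegree_modByMonic_lt _ hQ ?_
    rintro rfl
    simp at hdeg
  have hmod := congrArg (fun p => (p.map φ).eval (z k))
    (Polynomial.modByMonic_add_div ((Polynomial.X : Polynomial _) ^ m j) Q)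
  simp only [Polynomial.map_add, Polynomial.map_mul, Polynomial.eval_add, Polynomial.eval_mul,
    hroot, zero_mul, add_zero, Polynomial.map_pow, Polynomial.map_X, Polynomial.eval_pow,
    Polynomial.eval_X] at hmod
  rw [Matrix.of_apply, ← hmod, Polynomial.eval_eq_sum_range' hlt, Matrix.mul_apply,
    ← Finset.sum_range_reflect, Finset.sum_range]
  simp [c]

/-- On the hyperplane `∑ k, x k = 0`, if the entries of `μ` are natural numbers `m` up to a common
shift, then the antisymmetric exponential sum is a generalized Vandermonde determinant in the
`exp (2πi x k)`. -/
theorem sum_sign_mul_exp_eq_det {ι : Type*} [Fintype ι] [DecidableEq ι] (μ x : ι → ℝ) (t : ℝ)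
    (m : ι → ℕ) (hμ : ∀ i, μ i = m i + t) (hx : ∑ k, x k = 0) :
    ∑ s : Equiv.Perm ι, ((Equiv.Perm.sign s : ℤ) : ℂ) *
        Complex.exp (2 * Real.pi * Complex.I * ((∑ k, μ (s k) * x k : ℝ) : ℂ)) =
      (Matrix.of fun j k => Complex.exp (2 * Real.pi * Complex.I * x k) ^ m j).det := by
  rw [Matrix.det_apply']
  refine Finset.sum_congr rfl fun s _ => ?_
  have hshift : ∑ k, μ (s k) * x k = ∑ k, m (s k) * x k := by
    simp [hμ, add_mul, Finset.sum_add_distrib, ← Finset.mul_sum, hx]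
  simp only [hshift, Matrix.of_apply, ← Complex.exp_nat_mul, ← Complex.exp_sum]
  push_cast
  rw [Finset.mul_sum]
  congr 2
  exact Finset.sum_congr rfl fun k _ => by ring

/-- The multivariate Chebyshev polynomial of the second kind
`U_λ = S_{λ+ρ}/S_ρ` of `A_n`: for a strictly dominant, integral, normalized
`λ`, the antisymmetric sum `D⁻_λ` factors on the hyperplane `∑ x k = 0` as
`D⁻_δ` (with `δ(k) = n − k`) times a polynomial in the fundamental `C`-orbit
functions `X_1, …, X_n`. -/
theorem stmt_18 (n : ℕ) (hn : 1 ≤ n) (lam : Fin (n + 1) → ℝ)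
    (hdom : ∀ i : Fin n, lam i.succ < lam i.castSucc)
    (hint : ∀ i j : Fin (n + 1), ∃ m : ℤ, lam i - lam j = m)
    (hsum : ∑ k : Fin (n + 1), lam k = 0)
    (delta : Fin (n + 1) → ℝ) (hdelta : ∀ k : Fin (n + 1), delta k = (n : ℝ) - (k : ℕ)) :
    ∃ P : MvPolynomial (Fin n) ℂ,
      ∀ x : Fin (n + 1) → ℝ, (∑ k : Fin (n + 1), x k = 0) →
        ∑ s : Equiv.Perm (Fin (n + 1)),
            ((Equiv.Perm.sign s : ℤ) : ℂ) *
              Complex.exp (2 * Real.pi * Complex.I *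
                ((∑ k : Fin (n + 1), lam (s k) * x k : ℝ) : ℂ)) =
          (∑ s : Equiv.Perm (Fin (n + 1)),
              ((Equiv.Perm.sign s : ℤ) : ℂ) *
                Complex.exp (2 * Real.pi * Complex.I *
                  ((∑ k : Fin (n + 1), delta (s k) * x k : ℝ) : ℂ))) *
            MvPolynomial.eval
              (fun j : Fin n =>
                ∑ S ∈ (Finset.univ : Finset (Fin (n + 1))).powersetCard ((j : ℕ) + 1),
                  Complex.exp (2 * Real.pi * Complex.I * ((∑ k ∈ S, x k : ℝ) : ℂ))) P := by
  have hanti : StrictAnti lam := Fin.strictAnti_iff_succ_lt.2 hdom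
  have hnat (i : Fin (n + 1)) : ∃ m : ℕ, lam i = m + lam (Fin.last n) := by
    obtain ⟨a, ha⟩ := hint i (Fin.last n)
    have ha0 : (0 : ℝ) ≤ a := ha ▸ sub_nonneg.2 (hanti.antitone (Fin.le_last i))
    lift a to ℕ using by exact_mod_cast ha0
    exact ⟨a, by rw [← sub_eq_iff_eq_add, ha]; simp⟩
  choose m hm using hnat
  obtain ⟨P, hP⟩ := exists_det_pow_eq_det_vandermonde_mul_eval ℂ n m
  refine ⟨P, fun x hx => ?_⟩
  have hexp (S : Finset (Fin (n + 1))) :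
      Complex.exp (2 * Real.pi * Complex.I * ((∑ k ∈ S, x k : ℝ) : ℂ)) =
        ∏ k ∈ S, Complex.exp (2 * Real.pi * Complex.I * x k) := by
    rw [← Complex.exp_sum, Complex.ofReal_sum, Finset.mul_sum]
  rw [sum_sign_mul_exp_eq_det lam x _ m hm hx,
    sum_sign_mul_exp_eq_det delta x 0 (fun k => n - (k : ℕ))
      (fun k => by simp [hdelta, Nat.cast_sub k.is_le]) hx]
  simp only [hexp]
  exact hP _ (by rw [← hexp, hx]; simp)
end

section
/- Let n ≥ 1, let l : {0,1,…,n} → ℤ, and let s be any permutation of {0,1,…,n}. Then ∑_{k=0}^{n−1} (k+1)·(l(s(k)) − l(s(k+1))) ≡ ∑_{k=0}^{n−1} (k+1)·(l(k) − l(k+1)) (mod n+1). -/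
/-- Abel summation: the weighted sum of consecutive differences of `l` is the sum of its
values minus `n + 1` times the last one. -/
theorem sum_mul_sub_succ_eq {R : Type*} [CommRing R] (n : ℕ) (l : Fin (n + 1) → R) :
    ∑ k : Fin n, ((k : ℕ) + 1 : R) * (l k.castSucc - l k.succ) =
      ∑ k, l k - (n + 1) * l (Fin.last n) := by
  induction n with
  | zero => simp
  | succ n ih =>
    have h := ih fun k => l k.castSucc
    rw [Fin.sum_univ_castSucc, Fin.sum_univ_castSucc (f := l)]
    simp only [Fin.val_castSucc, Fin.succ_castSucc, Fin.val_last, Fin.succ_last] at h ⊢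
    rw [h]
    push_cast
    ring

/-- The congruence number `∑_k k·a_k mod (n+1)` of a weight of `A_n` (whose
ω-coordinates are the consecutive differences of its e-coordinates `l`) is
unchanged when the e-coordinates are permuted; hence it is constant on each
Weyl group orbit. -/
theorem stmt_19 (n : ℕ) (hn : 1 ≤ n) (l : Fin (n + 1) → ℤ)
    (s : Equiv.Perm (Fin (n + 1))) :
    (∑ k : Fin n, ((k : ℕ) + 1 : ℤ) * (l (s k.castSucc) - l (s k.succ))) ≡
      (∑ k : Fin n, ((k : ℕ) + 1 : ℤ) * (l k.castSucc - l k.succ)) [ZMOD (n + 1)] := by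
  have hs : ∑ k : Fin n, ((k : ℕ) + 1 : ℤ) * (l (s k.castSucc) - l (s k.succ)) =
      ∑ k, l (s k) - (n + 1) * l (s (Fin.last n)) :=
    sum_mul_sub_succ_eq n fun k => l (s k)
  rw [hs, sum_mul_sub_succ_eq, Equiv.sum_comp s l, Int.modEq_iff_dvd]
  exact ⟨l (s (Fin.last n)) - l (Fin.last n), by ring⟩
end
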